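/- There is an absolute constant C > 0 such that for every real U ≥ 1, every real N ≥ 1, and every finitely supported sequence β : ℕ → ℂ supported on the integers n with N < n ≤ 2N, one has ∫_{-U}^{U} | Σ_n β(n) n^{it} |² dt ≤ C (N + U) Σ_n |β(n)|². -/

import Mathlib

open Complex MeasureTheory

/-- Smoothing by a Gaussian: the mean square of a trigonometric polynomial over `[-U, U]` is
bounded by a quadratic form with Gaussian kernel in the frequency differences. -/
theorem intervalIntegral_norm_sq_sum_exp_le {ι : Type*} (s : Finset ι) (a : ι → ℂ) (l : ι → ℝ)
    {U : ℝ} (hU : 0 < U) :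
    (∫ t in (-U)..U, ‖∑ i ∈ s, a i * cexp (I * (l i * t : ℝ))‖ ^ 2) ≤
      Real.exp 1 * (√Real.pi * U *
        ∑ i ∈ s, ∑ j ∈ s, ‖a i‖ * ‖a j‖ * Real.exp (-(U / 2 * (l i - l j)) ^ 2)) := by
  set S : ℝ → ℂ := fun t ↦ ∑ i ∈ s, a i * cexp (I * (l i * t : ℝ)) with hS
  set b : ℝ := 1 / U ^ 2 with hb
  have hb0 : 0 < b := by positivity
  have hbre : 0 < (b : ℂ).re := by simpa using hb0
  have hexpand (t : ℝ) : ((‖S t‖ ^ 2 * Real.exp (-b * t ^ 2) : ℝ) : ℂ) =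
      ∑ i ∈ s, ∑ j ∈ s, a i * (starRingEnd ℂ) (a j) *
        (cexp (I * (l i - l j : ℝ) * t) * cexp (-b * t ^ 2)) := by
    rw [ofReal_mul, ofReal_pow, ← Complex.mul_conj', hS, map_sum, Finset.sum_mul_sum,
      Finset.sum_mul]
    refine Finset.sum_congr rfl fun i _ ↦ ?_
    rw [Finset.sum_mul]
    refine Finset.sum_congr rfl fun j _ ↦ ?_
    have h : cexp (I * (l i - l j : ℝ) * t) =
        cexp (I * (l i * t : ℝ)) * cexp (-(I * (l j * t : ℝ))) := by
      rw [← Complex.exp_add]; congr 1; push_cast; ring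
    rw [h, map_mul, ← Complex.exp_conj]
    simp only [map_mul, conj_I, conj_ofReal, neg_mul]
    push_cast
    ring
  have hint (c : ℝ) : Integrable fun t : ℝ ↦ cexp (I * c * t) * cexp (-b * t ^ 2) := by
    have := integrable_cexp_quadratic' (b := -(b : ℂ)) (by simpa using hb0) (I * c) 0
    refine this.congr (Filter.Eventually.of_forall fun t ↦ ?_)
    simp only [← Complex.exp_add]
    congr 1; ring
  have hintC : Integrable fun t : ℝ ↦ ((‖S t‖ ^ 2 * Real.exp (-b * t ^ 2) : ℝ) : ℂ) := by
    simp_rw [hexpand]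
    exact integrable_finsetSum _ fun i _ ↦ integrable_finsetSum _ fun j _ ↦ (hint _).const_mul _
  have hintR : Integrable fun t : ℝ ↦ ‖S t‖ ^ 2 * Real.exp (-b * t ^ 2) := by
    exact hintC.re
  have hnorm : ‖((Real.pi / b : ℂ)) ^ (1 / 2 : ℂ)‖ = √Real.pi * U := by
    have : (Real.pi / b : ℂ) ^ (1 / 2 : ℂ) = ((Real.pi / b) ^ (1 / 2 : ℝ) : ℝ) := by
      rw [ofReal_cpow (by positivity)]; push_cast; rfl
    rw [this, norm_real, ← Real.sqrt_eq_rpow, Real.norm_of_nonneg (by positivity), hb,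
      div_div_eq_mul_div, div_one, Real.sqrt_mul Real.pi_pos.le, Real.sqrt_sq hU.le]
  have hbound : ∫ t : ℝ, ‖S t‖ ^ 2 * Real.exp (-b * t ^ 2) ≤ √Real.pi * U *
        ∑ i ∈ s, ∑ j ∈ s, ‖a i‖ * ‖a j‖ * Real.exp (-(U / 2 * (l i - l j)) ^ 2) := by
    calc
      _ ≤ ‖((∫ t : ℝ, ‖S t‖ ^ 2 * Real.exp (-b * t ^ 2) : ℝ) : ℂ)‖ := by
        rw [norm_real]; exact le_abs_self _
      _ = ‖∑ i ∈ s, ∑ j ∈ s, a i * (starRingEnd ℂ) (a j) *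
            ((Real.pi / b : ℂ) ^ (1 / 2 : ℂ) * cexp (-((l i - l j : ℝ) : ℂ) ^ 2 / (4 * b)))‖ := by
        rw [← integral_complex_ofReal]
        simp_rw [hexpand]
        rw [integral_finsetSum _ fun i _ ↦
          integrable_finsetSum _ fun j _ ↦ (hint _).const_mul _]
        congr 1
        refine Finset.sum_congr rfl fun i _ ↦ ?_
        rw [integral_finsetSum _ fun j _ ↦ (hint _).const_mul _]
        refine Finset.sum_congr rfl fun j _ ↦ ?_
        rw [integral_const_mul, fourierIntegral_gaussian hbre]
      _ ≤ _ := by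
        rw [Finset.mul_sum]
        refine (norm_sum_le _ _).trans (Finset.sum_le_sum fun i _ ↦ ?_)
        rw [Finset.mul_sum]
        refine (norm_sum_le _ _).trans (Finset.sum_le_sum fun j _ ↦ le_of_eq ?_)
        have h : -((l i - l j : ℝ) : ℂ) ^ 2 / (4 * b) =
            ((-(U / 2 * (l i - l j)) ^ 2 : ℝ) : ℂ) := by
          have : (U : ℂ) ≠ 0 := by exact_mod_cast hU.ne'
          rw [hb]; push_cast; field_simp; ring
        rw [norm_mul, norm_mul, norm_mul, hnorm, h, ← ofReal_exp, norm_real, RCLike.norm_conj,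
          Real.norm_of_nonneg (Real.exp_pos _).le]
        ring
  have hScont : Continuous S := by fun_prop
  calc
    _ ≤ ∫ t in (-U)..U, Real.exp 1 * (‖S t‖ ^ 2 * Real.exp (-b * t ^ 2)) := by
      refine intervalIntegral.integral_mono_on (by linarith)
        (Continuous.intervalIntegrable (by fun_prop) _ _)
        (Continuous.intervalIntegrable (by fun_prop) _ _) fun t ht ↦ ?_
      have h1 : 1 ≤ Real.exp 1 * Real.exp (-b * t ^ 2) := by
        rw [← Real.exp_add]
        refine Real.one_le_exp ?_
        have : t ^ 2 ≤ U ^ 2 := sq_le_sq' ht.1 ht.2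
        have : b * t ^ 2 ≤ 1 := by
          rw [hb, one_div_mul_eq_div]
          exact div_le_one_of_le₀ this (by positivity)
        linarith
      calc ‖S t‖ ^ 2 = ‖S t‖ ^ 2 * 1 := (mul_one _).symm
        _ ≤ ‖S t‖ ^ 2 * (Real.exp 1 * Real.exp (-b * t ^ 2)) := by gcongr
        _ = _ := by ring
    _ = Real.exp 1 * ∫ t in (-U)..U, ‖S t‖ ^ 2 * Real.exp (-b * t ^ 2) :=
      intervalIntegral.integral_const_mul _ _
    _ ≤ Real.exp 1 * ∫ t : ℝ, ‖S t‖ ^ 2 * Real.exp (-b * t ^ 2) := by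
      rw [intervalIntegral.integral_of_le (by linarith)]
      gcongr
      · exact Filter.Eventually.of_forall fun t ↦ by positivity
      · exact Measure.restrict_le_self
    _ ≤ _ := by gcongr

/-- Schur's test for a symmetric nonnegative kernel. -/
theorem sum_sum_mul_le_of_row_sum_le {ι : Type*} (s : Finset ι) (x : ι → ℝ) (K : ι → ι → ℝ)
    {B : ℝ} (hK : ∀ i j, 0 ≤ K i j) (hsymm : ∀ i j, K i j = K j i)
    (hB : ∀ i ∈ s, ∑ j ∈ s, K i j ≤ B) :
    ∑ i ∈ s, ∑ j ∈ s, x i * x j * K i j ≤ B * ∑ i ∈ s, x i ^ 2 := by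
  have hrow : ∑ i ∈ s, ∑ j ∈ s, x i ^ 2 * K i j ≤ B * ∑ i ∈ s, x i ^ 2 := by
    rw [Finset.mul_sum]
    refine Finset.sum_le_sum fun i hi ↦ ?_
    rw [← Finset.mul_sum, mul_comm]
    exact mul_le_mul_of_nonneg_right (hB i hi) (sq_nonneg _)
  have hcol : ∑ i ∈ s, ∑ j ∈ s, x j ^ 2 * K i j = ∑ i ∈ s, ∑ j ∈ s, x i ^ 2 * K i j := by
    rw [Finset.sum_comm]
    simp_rw [fun i j ↦ hsymm j i]
  have hamgm : ∑ i ∈ s, ∑ j ∈ s, x i * x j * K i j ≤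
      ∑ i ∈ s, ∑ j ∈ s, (x i ^ 2 * K i j / 2 + x j ^ 2 * K i j / 2) :=
    Finset.sum_le_sum fun i _ ↦ Finset.sum_le_sum fun j _ ↦ by
      nlinarith [mul_nonneg (sq_nonneg (x i - x j)) (hK i j)]
  simp_rw [Finset.sum_add_distrib, ← Finset.sum_div] at hamgm
  linarith

/-- Row sums of a Gaussian kernel on the integers. -/
theorem sum_exp_neg_sq_mul_sub_le (s : Finset ℕ) (n : ℕ) {a : ℝ} (ha : 0 < a) :
    ∑ m ∈ s, Real.exp (-(a * ((m : ℝ) - n)) ^ 2) ≤ 2 * Real.exp (1 / 4) * (1 + 1 / a) := by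
  set r := Real.exp (-a) with hr
  have hr0 : 0 < r := Real.exp_pos _
  have hr1 : r < 1 := by simpa [hr] using ha
  have hgeom : (1 - r)⁻¹ ≤ 1 + 1 / a := by
    have h : r * (1 + a) ≤ 1 := by
      calc r * (1 + a) ≤ r * Real.exp a := by
            gcongr; linarith [Real.add_one_le_exp a]
        _ = 1 := by rw [hr, ← Real.exp_add]; simp
    rw [inv_le_iff_one_le_mul₀ (by linarith)]
    field_simp
    linarith
  have hterm (x : ℝ) (k : ℕ) (hx : x ^ 2 = (k : ℝ) ^ 2) :
      Real.exp (-(a * x) ^ 2) ≤ Real.exp (1 / 4) * r ^ k := by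
    rw [hr, ← Real.exp_nat_mul, ← Real.exp_add, Real.exp_le_exp, mul_pow, hx]
    nlinarith [sq_nonneg (a * k - 1 / 2)]
  have hsum (t : Finset ℕ) (f : ℕ → ℕ) (hf : Set.InjOn f t)
      (hft : ∀ m ∈ t, ((m : ℝ) - n) ^ 2 = (f m : ℝ) ^ 2) :
      ∑ m ∈ t, Real.exp (-(a * ((m : ℝ) - n)) ^ 2) ≤ Real.exp (1 / 4) * (1 + 1 / a) := by
    calc _ ≤ ∑ m ∈ t, Real.exp (1 / 4) * r ^ f m :=
          Finset.sum_le_sum fun m hm ↦ hterm _ _ (hft m hm)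
      _ = Real.exp (1 / 4) * ∑ k ∈ t.image f, r ^ k := by
          rw [← Finset.mul_sum, Finset.sum_image hf]
      _ ≤ Real.exp (1 / 4) * (1 - r)⁻¹ := by
          rw [← tsum_geometric_of_lt_one hr0.le hr1]
          gcongr
          exact (summable_geometric_of_lt_one hr0.le hr1).sum_le_tsum _ fun _ _ ↦ by positivity
      _ ≤ _ := by gcongr
  rw [← Finset.sum_filter_add_sum_filter_not s (n ≤ ·)]
  have h1 := hsum (s.filter (n ≤ ·)) (· - n)
    (fun x hx y hy h ↦ by simp at hx hy h; omega)
    (fun m hm ↦ by rw [Nat.cast_sub (Finset.mem_filter.1 hm).2])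
  have h2 := hsum (s.filter (¬ n ≤ ·)) (n - ·)
    (fun x hx y hy h ↦ by simp at hx hy h; omega)
    (fun m hm ↦ by rw [Nat.cast_sub (not_le.1 (Finset.mem_filter.1 hm).2).le]; ring)
  linarith

theorem sq_sub_div_le_sq_log_sub_log {x y M : ℝ} (hx : 0 < x) (hy : 0 < y) (hxM : x ≤ M)
    (hyM : y ≤ M) : ((x - y) / M) ^ 2 ≤ (Real.log x - Real.log y) ^ 2 := by
  wlog hxy : y ≤ x generalizing x y
  · have := this hy hx hyM hxM (not_le.1 hxy).le
    calc _ = ((y - x) / M) ^ 2 := by ring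
      _ ≤ _ := this
      _ = _ := by ring
  have h := Real.log_le_sub_one_of_pos (div_pos hy hx)
  rw [Real.log_div hy.ne' hx.ne'] at h
  have h' : (x - y) / M ≤ (x - y) / x := div_le_div_of_nonneg_left (by linarith) hx hxM
  have h'' : (x - y) / x = 1 - y / x := by field_simp
  refine pow_le_pow_left₀ (div_nonneg (by linarith) (by linarith)) (by linarith) 2

/-- Mean-value form of the large sieve for Dirichlet polynomials over a dyadic range:
`∫_{-U}^{U} |∑_n β(n) n^{it}|² dt ≤ C (N + U) ∑_n |β(n)|²`. -/
theorem large_sieve_mean_value :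
    ∃ C : ℝ, 0 < C ∧ ∀ U N : ℝ, 1 ≤ U → 1 ≤ N →
      ∀ β : ℕ → ℂ, (Function.support β).Finite →
        (Function.support β ⊆ {n : ℕ | N < n ∧ (n : ℝ) ≤ 2 * N}) →
        (∫ t in (-U)..U, ‖∑' n : ℕ, β n * (n : ℂ) ^ (Complex.I * t)‖ ^ 2)
          ≤ C * (N + U) * ∑' n : ℕ, ‖β n‖ ^ 2 := by
  refine ⟨Real.exp 1 * √Real.pi * (8 * Real.exp (1 / 4)), by positivity,
    fun U N hU hN β hfin hsupp ↦ ?_⟩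
  set s := hfin.toFinset with hs
  have hzero (n : ℕ) (hn : n ∉ s) : β n = 0 := by simpa [hs] using hn
  have hmem (n : ℕ) (hn : n ∈ s) : N < n ∧ (n : ℝ) ≤ 2 * N := hsupp (by simpa [hs] using hn)
  have hpoly (t : ℝ) : ∑' n : ℕ, β n * (n : ℂ) ^ (I * t) =
      ∑ n ∈ s, β n * cexp (I * (Real.log n * t : ℝ)) := by
    rw [tsum_eq_sum (s := s) fun n hn ↦ by rw [hzero n hn, zero_mul]]
    refine Finset.sum_congr rfl fun n hn ↦ ?_
    have hn0 : (n : ℂ) ≠ 0 := by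
      have : (0 : ℝ) < n := by linarith [(hmem n hn).1]
      exact_mod_cast this.ne'
    rw [cpow_def_of_ne_zero hn0, ← natCast_log]
    congr 2; push_cast; ring
  have hrow (n : ℕ) (hn : n ∈ s) :
      ∑ m ∈ s, Real.exp (-(U / 2 * (Real.log n - Real.log m)) ^ 2) ≤
        2 * Real.exp (1 / 4) * (1 + 1 / (U / (4 * N))) := by
    refine le_trans (Finset.sum_le_sum fun m hm ↦ ?_)
      (sum_exp_neg_sq_mul_sub_le s n (a := U / (4 * N)) (by positivity))
    have h := sq_sub_div_le_sq_log_sub_log (by linarith [(hmem m hm).1])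
      (by linarith [(hmem n hn).1]) (hmem m hm).2 (hmem n hn).2
    rw [Real.exp_le_exp, neg_le_neg_iff]
    calc (U / (4 * N) * ((m : ℝ) - n)) ^ 2 = (U / 2) ^ 2 * (((m : ℝ) - n) / (2 * N)) ^ 2 := by
          field_simp; ring
      _ ≤ (U / 2) ^ 2 * (Real.log m - Real.log n) ^ 2 := by gcongr
      _ = _ := by ring
  have hschur := sum_sum_mul_le_of_row_sum_le s (fun n ↦ ‖β n‖)
    (fun n m : ℕ ↦ Real.exp (-(U / 2 * (Real.log n - Real.log m)) ^ 2))
    (fun _ _ ↦ (Real.exp_pos _).le) (fun n m ↦ by congr 1; ring) hrow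
  simp_rw [hpoly]
  rw [tsum_eq_sum (s := s) fun n hn ↦ by simp [hzero n hn]]
  calc _ ≤ _ := intervalIntegral_norm_sq_sum_exp_le s β (fun n ↦ Real.log n) (by linarith)
    _ ≤ Real.exp 1 * (√Real.pi * U * (2 * Real.exp (1 / 4) * (1 + 1 / (U / (4 * N))) *
        ∑ n ∈ s, ‖β n‖ ^ 2)) := by gcongr
    _ = Real.exp 1 * √Real.pi * (2 * Real.exp (1 / 4)) * (4 * N + U) * ∑ n ∈ s, ‖β n‖ ^ 2 := by
      field_simp; ring
    _ ≤ Real.exp 1 * √Real.pi * (2 * Real.exp (1 / 4)) * (4 * (N + U)) * ∑ n ∈ s, ‖β n‖ ^ 2 := by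
      gcongr; linarith
    _ = _ := by ring
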